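/- Under the error-free backward-backward iteration, the fundamental inequality Φ(x_{n+1}, y_n) ≤ Φ(x, y) + (1/(2γ))(d(x_n, x)² − d(x_{n+1}, x)²) holds for all n ≥ 0 and all x, y ∈ X. -/

import Mathlib

open Set Filter Topology

/-- The objective `Φ(x,y) = f(x) + g(y) + (1/(2γ)) d(x,y)²` of the backward-backward
splitting problem (with `t` playing the role of `γ > 0`). -/
noncomputable def Phi {X : Type*} [MetricSpace X] (f g : X → EReal) (t : ℝ)
    (x y : X) : EReal :=
  f x + g y + (((1 / (2 * t)) * dist x y ^ 2 : ℝ) : EReal)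

/-- The quadrilateral inequality in a space satisfying the comparison inequality for midpoints. -/
theorem quadrilateral_inequality {X : Type*} [MetricSpace X] {x b m : X}
    (hm : ∀ z : X, dist z m ^ 2 ≤ (1 / 2) * dist z x ^ 2 + (1 / 2) * dist z b ^ 2
      - (1 / 4) * dist x b ^ 2) (y a : X) :
    dist x b ^ 2 + dist y a ^ 2
      ≤ dist x y ^ 2 + dist y b ^ 2 + dist a b ^ 2 + dist x a ^ 2 := by
  have hy := hm y
  have ha := hm a
  have htri := dist_triangle_right y a m
  have hsq : dist y a ^ 2 ≤ (dist y m + dist a m) ^ 2 := by gcongr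
  rw [dist_comm y x] at hy
  rw [dist_comm a x] at ha
  linarith [sq_nonneg (dist y m - dist a m)]

/-- The variational inequality satisfied by a proximal point `p` of `a`: the function value at `p`
is finite, and the minimality of `p` self-improves by the term `(1/2) d(p,z)²`. -/
theorem prox_variational_inequality {X : Type*} [MetricSpace X] {G : X → X → ℝ → X}
    (hcmp : ∀ x y z : X, ∀ l ∈ Icc (0:ℝ) 1,
      dist z (G x y l) ^ 2 ≤ (1 - l) * dist z x ^ 2 + l * dist z y ^ 2
        - l * (1 - l) * dist x y ^ 2)
    {h : X → EReal} (hbot : ∀ a, h a ≠ ⊥)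
    (hconv : ∀ a b : X, ∀ l ∈ Icc (0:ℝ) 1,
      h (G a b l) ≤ ((1 - l : ℝ) : EReal) * h a + ((l : ℝ) : EReal) * h b)
    {t : ℝ} (ht : 0 < t) {a p : X}
    (hp : ∀ z : X, ((t : ℝ) : EReal) * h p + (((1/2) * dist a p ^ 2 : ℝ) : EReal)
        ≤ ((t : ℝ) : EReal) * h z + (((1/2) * dist a z ^ 2 : ℝ) : EReal))
    {z : X} {r : ℝ} (hz : h z = r) :
    ∃ s : ℝ, h p = s ∧
      t * s + (1/2) * dist a p ^ 2 + (1/2) * dist p z ^ 2 ≤ t * r + (1/2) * dist a z ^ 2 := by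
  have hptop : h p ≠ ⊤ := by
    intro htop
    have := hp z
    rw [htop, hz, EReal.coe_mul_top_of_pos ht, EReal.top_add_coe, ← EReal.coe_mul,
      ← EReal.coe_add, top_le_iff] at this
    exact EReal.coe_ne_top _ this
  obtain ⟨s, hs⟩ : ∃ s : ℝ, h p = s := ⟨_, (EReal.coe_toReal hptop (hbot p)).symm⟩
  refine ⟨s, hs, ?_⟩
  have hseg : ∀ l ∈ Ioo (0:ℝ) 1,
      t * s + (1/2) * dist a p ^ 2 + (1/2) * (1 - l) * dist p z ^ 2
        ≤ t * r + (1/2) * dist a z ^ 2 := by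
    intro l hl
    have hc := hconv p z l (Ioo_subset_Icc_self hl)
    rw [hs, hz, ← EReal.coe_mul, ← EReal.coe_mul, ← EReal.coe_add] at hc
    have hq := (EReal.coe_toReal (ne_top_of_le_ne_top (EReal.coe_ne_top _) hc)
      (hbot (G p z l))).symm
    have hmin := hp (G p z l)
    rw [hq, EReal.coe_le_coe_iff] at hc
    rw [hq, hs, ← EReal.coe_mul, ← EReal.coe_mul, ← EReal.coe_add, ← EReal.coe_add,
      EReal.coe_le_coe_iff] at hmin
    have hd := hcmp p z a l (Ioo_subset_Icc_self hl)
    have hct := mul_le_mul_of_nonneg_left hc ht.le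
    refine le_of_mul_le_mul_left ?_ hl.1
    linarith
  have hlim : Tendsto (fun l : ℝ => t * s + (1/2) * dist a p ^ 2 + (1/2) * (1 - l) * dist p z ^ 2)
      (𝓝[>] 0) (𝓝 (t * s + (1/2) * dist a p ^ 2 + (1/2) * (1 - 0) * dist p z ^ 2)) :=
    (Continuous.tendsto (by fun_prop) 0).mono_left nhdsWithin_le_nhds
  rw [sub_zero, mul_one] at hlim
  exact le_of_tendsto hlim (Filter.mem_of_superset (Ioo_mem_nhdsGT one_pos) hseg)

/-- Error-free backward-backward iteration: the fundamental inequality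
`Φ(x_{n+1}, y_n) ≤ Φ(a,b) + (1/(2γ))(d(x_n,a)² − d(x_{n+1},a)²)` holds for all `n ≥ 0`
and all `a, b ∈ X`. -/
theorem bb_errorfree_fundamental_inequality
    {X : Type*} [MetricSpace X] [CompleteSpace X]
    (G : X → X → ℝ → X)
    (hG0 : ∀ x y, G x y 0 = x) (hG1 : ∀ x y, G x y 1 = y)
    (hGd : ∀ x y, ∀ s ∈ Icc (0:ℝ) 1, ∀ u ∈ Icc (0:ℝ) 1,
      dist (G x y s) (G x y u) = |s - u| * dist x y)
    (hcmp : ∀ x y z : X, ∀ l ∈ Icc (0:ℝ) 1,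
      dist z (G x y l) ^ 2 ≤ (1 - l) * dist z x ^ 2 + l * dist z y ^ 2
        - l * (1 - l) * dist x y ^ 2)
    (f g : X → EReal)
    (hfproper : ∃ a, f a ≠ ⊤) (hfbot : ∀ a, f a ≠ ⊥)
    (hfconv : ∀ a b : X, ∀ l ∈ Icc (0:ℝ) 1,
      f (G a b l) ≤ ((1 - l : ℝ) : EReal) * f a + ((l : ℝ) : EReal) * f b)
    (hflsc : LowerSemicontinuous f)
    (hgproper : ∃ a, g a ≠ ⊤) (hgbot : ∀ a, g a ≠ ⊥)
    (hgconv : ∀ a b : X, ∀ l ∈ Icc (0:ℝ) 1,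
      g (G a b l) ≤ ((1 - l : ℝ) : EReal) * g a + ((l : ℝ) : EReal) * g b)
    (hglsc : LowerSemicontinuous g)
    (t : ℝ) (ht : 0 < t)
    -- `proxf x = Prox_{t·f}(x)` and `proxg x = Prox_{t·g}(x)`:
    (proxf proxg : X → X)
    (hproxf : ∀ a z : X,
      ((t : ℝ) : EReal) * f (proxf a) + (((1/2) * dist a (proxf a) ^ 2 : ℝ) : EReal)
        ≤ ((t : ℝ) : EReal) * f z + (((1/2) * dist a z ^ 2 : ℝ) : EReal))
    (hproxg : ∀ a z : X,
      ((t : ℝ) : EReal) * g (proxg a) + (((1/2) * dist a (proxg a) ^ 2 : ℝ) : EReal)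
        ≤ ((t : ℝ) : EReal) * g z + (((1/2) * dist a z ^ 2 : ℝ) : EReal))
    (x y : ℕ → X)
    (hy : ∀ n, y n = proxg (x n))
    (hx : ∀ n, x (n + 1) = proxf (y n))
    : ∀ n : ℕ, ∀ a b : X,
      Phi f g t (x (n + 1)) (y n)
        ≤ Phi f g t a b
          + (((1 / (2 * t)) * (dist (x n) a ^ 2 - dist (x (n + 1)) a ^ 2) : ℝ) : EReal) := by
  intro n a b
  unfold Phi
  by_cases hfa : f a = ⊤
  · rw [hfa, EReal.top_add_of_ne_bot (hgbot b), EReal.top_add_coe, EReal.top_add_coe]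
    exact le_top
  by_cases hgb : g b = ⊤
  · rw [hgb, EReal.add_top_of_ne_bot (hfbot a), EReal.top_add_coe, EReal.top_add_coe]
    exact le_top
  have hfa' := (EReal.coe_toReal hfa (hfbot a)).symm
  have hgb' := (EReal.coe_toReal hgb (hgbot b)).symm
  obtain ⟨s, hs, hfs⟩ := prox_variational_inequality hcmp hfbot hfconv ht (hproxf (y n)) hfa'
  obtain ⟨r, hr, hgr⟩ := prox_variational_inequality hcmp hgbot hgconv ht (hproxg (x n)) hgb'
  rw [← hx n] at hs hfs
  rw [← hy n] at hr hgr
  have hquad := quadrilateral_inequality (x := x n) (b := b) (m := G (x n) b (1/2))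
    (fun z => (hcmp (x n) b z (1/2) (by norm_num)).trans_eq (by ring)) (y n) a
  rw [hfa', hgb', hs, hr]
  simp only [← EReal.coe_add, EReal.coe_le_coe_iff]
  rw [dist_comm (y n) (x (n + 1))] at hfs
  refine le_of_mul_le_mul_left ?_ ht
  have hcancel : ∀ c : ℝ, t * (1 / (2 * t) * c) = (1 / 2) * c := fun c => by field_simp
  simp only [mul_add, hcancel]
  linarith
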